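/- Side-information rate bound in the Case-1 rate-distortion converse: let n be a positive integer, let (S₁,ᵢ, S₂,ᵢ), i = 1,...,n, be i.i.d. pairs of random variables with values in finite sets, and let T₁ be any random variable with values in a finite set on the same probability space. Then H(T₁) ≥ Σ_{i=1}^n I( S₁,ᵢ ; (T₁, S₁,ᵢ₊₁^n, S₂^{i−1}, S₂,ᵢ₊₁^n) | S₂,ᵢ ). -/

import Mathlib

open scoped Classical

/-- The probability of the event `f = a` under the pmf `P` on a finite space. -/
noncomputable def pr {Ω A : Type*} [Fintype Ω] (P : Ω → ℝ) (f : Ω → A) (a : A) : ℝ :=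
  ∑ ω, if f ω = a then P ω else 0

/-- Shannon entropy `H(f)` (convention `0 log 0 = 0`, automatic since `Real.log 0 = 0`). -/
noncomputable def ent {Ω A : Type*} [Fintype Ω] [Fintype A] (P : Ω → ℝ) (f : Ω → A) : ℝ :=
  -∑ a, pr P f a * Real.log (pr P f a)

/-- Mutual information `I(f;g) = H(f) + H(g) − H(f,g)`. -/
noncomputable def mi {Ω A B : Type*} [Fintype Ω] [Fintype A] [Fintype B]
    (P : Ω → ℝ) (f : Ω → A) (g : Ω → B) : ℝ :=
  ent P f + ent P g - ent P (fun ω => (f ω, g ω))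

/-- Conditional mutual information `I(f;g|h) = H(f,h) + H(g,h) − H(f,g,h) − H(h)`. -/
noncomputable def cmi {Ω A B C : Type*} [Fintype Ω] [Fintype A] [Fintype B] [Fintype C]
    (P : Ω → ℝ) (f : Ω → A) (g : Ω → B) (h : Ω → C) : ℝ :=
  ent P (fun ω => (f ω, h ω)) + ent P (fun ω => (g ω, h ω)) -
    ent P (fun ω => (f ω, g ω, h ω)) - ent P h

/-- The prefix tuple `A^{i-1} = (A₁, …, A_{i−1})` of a finite sequence of random
variables (as a single random variable). -/
def pre {Ω A : Type*} {n : ℕ} (f : Fin n → Ω → A) (i : Fin n) :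
    Ω → (Fin i.val → A) :=
  fun ω j => f ⟨j.val, j.isLt.trans i.isLt⟩ ω

/-- The suffix tuple `A_{i+1}^n = (A_{i+1}, …, A_n)` of a finite sequence of random
variables (as a single random variable). -/
def suf {Ω A : Type*} {n : ℕ} (f : Fin n → Ω → A) (i : Fin n) :
    Ω → (Fin (n - (i.val + 1)) → A) :=
  fun ω j => f ⟨i.val + 1 + j.val, by have h1 := j.isLt; have h2 := i.isLt; omega⟩ ω

section Entropy

variable {Ω A B : Type*} [Fintype Ω]

lemma pr_nonneg {P : Ω → ℝ} (hP : ∀ ω, 0 ≤ P ω) (f : Ω → A) (a : A) : 0 ≤ pr P f a :=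
  Finset.sum_nonneg fun ω _ => by split_ifs <;> simp [hP ω]

lemma le_pr_self {P : Ω → ℝ} (hP : ∀ ω, 0 ≤ P ω) (f : Ω → A) (ω : Ω) : P ω ≤ pr P f (f ω) := by
  have h := Finset.single_le_sum (f := fun ω' => if f ω' = f ω then P ω' else 0)
    (fun ω' _ => by split_ifs <;> simp [hP ω']) (Finset.mem_univ ω)
  simpa [pr] using h

/-- Change of variables for expectations on a finite space. -/
lemma sum_pr_mul [Fintype A] (P : Ω → ℝ) (f : Ω → A) (F : A → ℝ) :
    ∑ a, pr P f a * F a = ∑ ω, P ω * F (f ω) := by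
  simp only [pr, Finset.sum_mul]
  rw [Finset.sum_comm]
  simp [ite_mul]

lemma sum_pr [Fintype A] (P : Ω → ℝ) (f : Ω → A) : ∑ a, pr P f a = ∑ ω, P ω := by
  simpa using sum_pr_mul P f fun _ => 1

lemma pr_comp [Fintype A] (P : Ω → ℝ) (f : Ω → A) (φ : A → B) (b : B) :
    pr P (fun ω => φ (f ω)) b = ∑ a, if φ a = b then pr P f a else 0 := by
  simpa [pr] using (sum_pr_mul P f fun a => if φ a = b then 1 else 0).symm

lemma pr_comp_injective (P : Ω → ℝ) (f : Ω → A) {φ : A → B} (hφ : φ.Injective) (a : A) :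
    pr P (fun ω => φ (f ω)) (φ a) = pr P f a := by
  simp [pr, hφ.eq_iff]

lemma ent_eq_sum [Fintype A] (P : Ω → ℝ) (f : Ω → A) :
    ent P f = -∑ ω, P ω * Real.log (pr P f (f ω)) := by
  rw [ent, sum_pr_mul P f fun a => Real.log (pr P f a)]

/-- Random variables that determine each other have the same entropy. -/
lemma ent_congr [Fintype A] [Fintype B] (P : Ω → ℝ) (f : Ω → A) (g : Ω → B)
    (h : ∀ ω ω', f ω = f ω' ↔ g ω = g ω') : ent P f = ent P g := by
  simp only [ent_eq_sum, pr, h]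

/-- A function of a random variable has at most its entropy. -/
lemma ent_le_of_determines [Fintype A] [Fintype B] {P : Ω → ℝ} (hP : ∀ ω, 0 ≤ P ω)
    (f : Ω → A) (g : Ω → B) (h : ∀ ω ω', g ω = g ω' → f ω = f ω') : ent P f ≤ ent P g := by
  rw [ent_eq_sum, ent_eq_sum, neg_le_neg_iff]
  refine Finset.sum_le_sum fun ω _ => ?_
  rcases (hP ω).eq_or_lt with h0 | h0
  · simp [← h0]
  refine mul_le_mul_of_nonneg_left (Real.log_le_log (h0.trans_le (le_pr_self hP g ω)) ?_) (hP ω)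
  refine Finset.sum_le_sum fun ω' _ => ?_
  by_cases hg : g ω' = g ω
  · simp [hg, h _ _ hg]
  · rw [if_neg hg]
    split_ifs <;> simp [hP ω']

/-- Subadditivity of entropy. -/
lemma ent_prod_le [Fintype A] [Fintype B] {P : Ω → ℝ} (hP : ∀ ω, 0 ≤ P ω) (hP1 : ∑ ω, P ω = 1)
    (f : Ω → A) (g : Ω → B) : ent P (fun ω => (f ω, g ω)) ≤ ent P f + ent P g := by
  set p : A × B → ℝ := pr P fun ω => (f ω, g ω) with hp
  have hpoint : ∀ ω, P ω * Real.log (pr P f (f ω)) + P ω * Real.log (pr P g (g ω))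
      - P ω * Real.log (p (f ω, g ω))
      ≤ P ω * (pr P f (f ω) * pr P g (g ω) / p (f ω, g ω)) - P ω := by
    intro ω
    rcases (hP ω).eq_or_lt with h0 | h0
    · simp [← h0]
    have h1 := h0.trans_le (le_pr_self hP f ω)
    have h2 := h0.trans_le (le_pr_self hP g ω)
    have h3 : 0 < p (f ω, g ω) := h0.trans_le (le_pr_self hP (fun ω => (f ω, g ω)) ω)
    have h4 := Real.log_le_sub_one_of_pos (div_pos (mul_pos h1 h2) h3)
    rw [Real.log_div (mul_pos h1 h2).ne' h3.ne', Real.log_mul h1.ne' h2.ne'] at h4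
    linarith [mul_le_mul_of_nonneg_left h4 h0.le]
  have hle : ∑ ω, P ω * (pr P f (f ω) * pr P g (g ω) / p (f ω, g ω)) ≤ 1 := by
    rw [← sum_pr_mul P (fun ω => (f ω, g ω)) fun x => pr P f x.1 * pr P g x.2 / p x, ← hp]
    calc ∑ x, p x * (pr P f x.1 * pr P g x.2 / p x)
        ≤ ∑ x : A × B, pr P f x.1 * pr P g x.2 := by
          refine Finset.sum_le_sum fun x _ => ?_
          by_cases hx : p x = 0
          · simpa [hx] using mul_nonneg (pr_nonneg hP f x.1) (pr_nonneg hP g x.2)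
          · rw [mul_div_cancel₀ _ hx]
      _ = 1 := by
          rw [Fintype.sum_prod_type, ← Finset.sum_mul_sum, sum_pr, sum_pr, hP1, one_mul]
  have hsum := Finset.sum_le_sum fun ω (_ : ω ∈ Finset.univ) => hpoint ω
  simp only [Finset.sum_sub_distrib, Finset.sum_add_distrib] at hsum
  rw [ent_eq_sum, ent_eq_sum, ent_eq_sum]
  linarith

lemma pr_of_pr_pi_eq_prod {ι : Type*} [Fintype ι] [DecidableEq ι] [Fintype A] (P : Ω → ℝ) (X : ι → Ω → A)
    (ν : A → ℝ) (hν : ∑ a, ν a = 1)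
    (hX : ∀ x : ι → A, pr P (fun ω i => X i ω) x = ∏ i, ν (x i)) (i : ι) (a : A) :
    pr P (X i) a = ν a := by
  have h := pr_comp P (fun ω i => X i ω) (fun x => x i) a
  simp only [hX] at h
  rw [h]
  calc ∑ x : ι → A, (if x i = a then ∏ j, ν (x j) else 0)
      = ∑ x : ι → A, ∏ j, (if j = i then (if x j = a then ν (x j) else 0) else ν (x j)) := by
        refine Finset.sum_congr rfl fun x _ => ?_
        split_ifs with hx
        · refine Finset.prod_congr rfl fun j _ => ?_
          by_cases hj : j = i
          · subst hj; simp [hx]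
          · simp [hj]
        · exact (Finset.prod_eq_zero (Finset.mem_univ i) (by simp [hx])).symm
    _ = ∏ j, ∑ c, (if j = i then (if c = a then ν c else 0) else ν c) := by
        rw [Finset.prod_univ_sum, Fintype.piFinset_univ]
    _ = ν a := by
        rw [Finset.prod_eq_single i] <;> simp +contextual [hν]

/-- The entropy of an i.i.d. family is the sum of the marginal entropies. -/
lemma ent_pi_eq_sum {ι : Type*} [Fintype ι] [DecidableEq ι] [Fintype A] {P : Ω → ℝ} (hP : ∀ ω, 0 ≤ P ω)
    (X : ι → Ω → A) (ν : A → ℝ) (hν : ∑ a, ν a = 1)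
    (hX : ∀ x : ι → A, pr P (fun ω i => X i ω) x = ∏ i, ν (x i)) :
    ent P (fun ω i => X i ω) = ∑ i, ent P (X i) := by
  simp only [ent_eq_sum, pr_of_pr_pi_eq_prod P X ν hν hX, hX, Finset.sum_neg_distrib]
  rw [Finset.sum_comm]
  congr 1
  refine Finset.sum_congr rfl fun ω _ => ?_
  rcases (hP ω).eq_or_lt with h0 | h0
  · simp [← h0]
  have h1 := h0.trans_le (le_pr_self hP (fun ω i => X i ω) ω)
  rw [hX] at h1
  rw [Real.log_prod fun i hi => Finset.prod_ne_zero_iff.1 h1.ne' i hi, Finset.mul_sum]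

end Entropy

section Tuples

variable {Ω A : Type*}

lemma pre_eq_iff {n : ℕ} (f : Fin n → Ω → A) (i : Fin n) (ω ω' : Ω) :
    pre f i ω = pre f i ω' ↔ ∀ j < i, f j ω = f j ω' :=
  ⟨fun h j hj => congrFun h ⟨j, hj⟩, fun h => funext fun j => h _ (Fin.lt_def.2 j.isLt)⟩

lemma suf_eq_iff {n : ℕ} (f : Fin n → Ω → A) (i : Fin n) (ω ω' : Ω) :
    suf f i ω = suf f i ω' ↔ ∀ j > i, f j ω = f j ω' := by
  refine ⟨fun h j hj => ?_, fun h => funext fun j => h _ (Fin.lt_def.2 (by simp; omega))⟩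
  have hj' : i.val < j.val := hj
  have h1 := congrFun h ⟨j.val - (i.val + 1), by omega⟩
  have h2 : i.val + 1 + (j.val - (i.val + 1)) = j.val := by omega
  simpa only [suf, h2] using h1

/-- The tuple of the entries of `f` with index at least `k`, the others being masked. -/
def maskBelow {n : ℕ} (f : Fin n → Ω → A) (k : ℕ) (ω : Ω) : Fin n → Option A :=
  fun j => if k ≤ j.val then some (f j ω) else none

lemma maskBelow_eq_iff {n : ℕ} (f : Fin n → Ω → A) (k : ℕ) (ω ω' : Ω) :
    maskBelow f k ω = maskBelow f k ω' ↔ ∀ j : Fin n, k ≤ j.val → f j ω = f j ω' := by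
  rw [funext_iff]
  refine forall_congr' fun j => ?_
  by_cases h : k ≤ j.val <;> simp [maskBelow, h]

end Tuples

/-- side-information rate bound in the Case-1 rate-distortion converse.
If `(S₁,ᵢ, S₂,ᵢ)`, `i = 1,…,n`, are i.i.d. pairs with common pmf `μ` and `T₁` is any
random variable on the same space, then
`H(T₁) ≥ Σᵢ I(S₁,ᵢ ; T₁, S₁,ᵢ₊₁^n, S₂^{i−1}, S₂,ᵢ₊₁^n | S₂,ᵢ)`. -/
theorem case1_side_rate {Ω A1 A2 Tt : Type*}
    [Fintype Ω] [Fintype A1] [Fintype A2] [Fintype Tt]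
    {n : ℕ} (hn : 0 < n)
    (P : Ω → ℝ) (hP0 : ∀ ω, 0 ≤ P ω) (hP1 : ∑ ω, P ω = 1)
    (S1 : Fin n → Ω → A1) (S2 : Fin n → Ω → A2)
    (μ : A1 → A2 → ℝ) (hμ0 : ∀ a b, 0 ≤ μ a b) (hμ1 : ∑ a, ∑ b, μ a b = 1)
    (hiid : ∀ (a : Fin n → A1) (b : Fin n → A2),
      pr P (fun ω => ((fun i => S1 i ω), (fun i => S2 i ω))) (a, b) =
        ∏ i, μ (a i) (b i))
    (T1 : Ω → Tt) :
    ∑ i : Fin n,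
        cmi P (S1 i)
          (fun ω => (T1 ω, suf S1 i ω, pre S2 i ω, suf S2 i ω)) (S2 i) ≤
      ent P T1 := by
  have hcmi : ∀ i : Fin n,
      cmi P (S1 i) (fun ω => (T1 ω, suf S1 i ω, pre S2 i ω, suf S2 i ω)) (S2 i) =
        ent P (fun ω => (S1 i ω, S2 i ω)) - ent P (S2 i) +
        (ent P (fun ω => (T1 ω, maskBelow S1 (i.val + 1) ω, fun j => S2 j ω)) -
          ent P (fun ω => (T1 ω, maskBelow S1 i.val ω, fun j => S2 j ω))) := by
    intro i
    have hS2 : ∀ ω ω', ((∀ j < i, S2 j ω = S2 j ω') ∧ (∀ j > i, S2 j ω = S2 j ω') ∧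
        S2 i ω = S2 i ω') ↔ (fun j => S2 j ω) = fun j => S2 j ω' := by
      intro ω ω'
      rw [funext_iff]
      refine ⟨fun ⟨h1, h2, h3⟩ j => ?_, fun h => ⟨fun j _ => h j, fun j _ => h j, h i⟩⟩
      rcases lt_trichotomy j i with h | rfl | h
      exacts [h1 j h, h3, h2 j h]
    have hS1 : ∀ ω ω', (∀ j : Fin n, i.val ≤ j.val → S1 j ω = S1 j ω') ↔
        S1 i ω = S1 i ω' ∧ ∀ j > i, S1 j ω = S1 j ω' := by
      refine fun ω ω' => ⟨fun h => ⟨h i le_rfl, fun j hj => h j (Fin.le_def.1 hj.le)⟩,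
        fun ⟨h1, h2⟩ j hj => ?_⟩
      rcases (Fin.le_def.2 hj).eq_or_lt with rfl | h
      exacts [h1, h2 j h]
    have hS1' : ∀ ω ω', (∀ j : Fin n, i.val + 1 ≤ j.val → S1 j ω = S1 j ω') ↔
        ∀ j > i, S1 j ω = S1 j ω' := fun ω ω' => Iff.rfl
    have e1 := ent_congr P
      (fun ω => ((T1 ω, suf S1 i ω, pre S2 i ω, suf S2 i ω), S2 i ω))
      (fun ω => (T1 ω, maskBelow S1 (i.val + 1) ω, fun j => S2 j ω)) fun ω ω' => by
        simp only [Prod.mk.injEq, suf_eq_iff, pre_eq_iff, maskBelow_eq_iff, hS1', ← hS2]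
        tauto
    have e2 := ent_congr P
      (fun ω => (S1 i ω, (T1 ω, suf S1 i ω, pre S2 i ω, suf S2 i ω), S2 i ω))
      (fun ω => (T1 ω, maskBelow S1 i.val ω, fun j => S2 j ω)) fun ω ω' => by
        simp only [Prod.mk.injEq, suf_eq_iff, pre_eq_iff, maskBelow_eq_iff, hS1, ← hS2]
        tauto
    rw [cmi, e1, e2]
    ring
  have hjoint : ent P (fun ω => ((fun i => S1 i ω), (fun i => S2 i ω))) =
      ∑ i, ent P (fun ω => (S1 i ω, S2 i ω)) := by
    rw [← ent_pi_eq_sum hP0 (fun i ω => (S1 i ω, S2 i ω)) (fun x => μ x.1 x.2)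
      (by rw [Fintype.sum_prod_type, hμ1])]
    · exact ent_congr _ _ _ fun ω ω' => by simp [funext_iff, forall_and]
    · intro x
      rw [← hiid]
      have hinj : Function.Injective fun x : Fin n → A1 × A2 =>
          ((fun i => (x i).1), (fun i => (x i).2)) := fun x y h => by
        simp only [Prod.mk.injEq, funext_iff] at h
        exact funext fun i => Prod.ext (h.1 i) (h.2 i)
      exact (pr_comp_injective P (fun ω i => (S1 i ω, S2 i ω)) hinj x).symm
  have hside : ent P (fun ω i => S2 i ω) = ∑ i, ent P (S2 i) := by
    refine ent_pi_eq_sum hP0 S2 (fun b => ∑ a, μ a b) (by rw [Finset.sum_comm, hμ1]) fun b => ?_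
    have h := pr_comp P (fun ω => ((fun i => S1 i ω), (fun i => S2 i ω))) Prod.snd b
    rw [h, Fintype.sum_prod_type, Finset.prod_univ_sum, Fintype.piFinset_univ]
    simp [hiid]
  have htele : ∑ i : Fin n,
      (ent P (fun ω => (T1 ω, maskBelow S1 (i.val + 1) ω, fun j => S2 j ω)) -
        ent P (fun ω => (T1 ω, maskBelow S1 i.val ω, fun j => S2 j ω))) =
      ent P (fun ω => (T1 ω, maskBelow S1 n ω, fun j => S2 j ω)) -
        ent P (fun ω => (T1 ω, maskBelow S1 0 ω, fun j => S2 j ω)) := by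
    rw [Fin.sum_univ_eq_sum_range fun k =>
      ent P (fun ω => (T1 ω, maskBelow S1 (k + 1) ω, fun j => S2 j ω)) -
        ent P (fun ω => (T1 ω, maskBelow S1 k ω, fun j => S2 j ω))]
    exact Finset.sum_range_sub
      (fun k => ent P (fun ω => (T1 ω, maskBelow S1 k ω, fun j => S2 j ω))) n
  have hlast : ent P (fun ω => (T1 ω, maskBelow S1 n ω, fun j => S2 j ω)) =
      ent P (fun ω => (T1 ω, fun j => S2 j ω)) :=
    ent_congr _ _ _ fun ω ω' => by
      have : ∀ j : Fin n, ¬ n ≤ j.val := fun j => j.isLt.not_ge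
      simp [maskBelow_eq_iff, this]
  have hfirst : ent P (fun ω => ((fun i => S1 i ω), (fun i => S2 i ω))) ≤
      ent P (fun ω => (T1 ω, maskBelow S1 0 ω, fun j => S2 j ω)) :=
    ent_le_of_determines hP0 _ _ fun ω ω' => by
      simp only [Prod.mk.injEq, maskBelow_eq_iff, Nat.zero_le, true_imp_iff]
      exact fun ⟨_, h1, h2⟩ => ⟨funext h1, h2⟩
  have hsub := ent_prod_le hP0 hP1 T1 fun ω j => S2 j ω
  simp only [hcmi, Finset.sum_add_distrib, Finset.sum_sub_distrib] at htele ⊢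
  linarith
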